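/- arXiv:2111.11769 — 9 statements merged into one kernel-verified Lean document; each statement's English description precedes it below -/
import Mathlib

section
/- Strong Lagrange duality on the relative interior of the domain: let D be a nonempty type, ι a finite type, f : D → ℝ a nonnegative function, and g : D → (ι → ℝ). Define the value function L : (ι → ℝ) → [0,+∞] by L(Γ) := inf { f(x) : x ∈ D, g(x) = Γ }, with the convention inf ∅ = +∞. Assume L is convex: for all Γ₁, Γ₂ ∈ (ι → ℝ) and all t ∈ [0,1], L(t·Γ₁ + (1−t)·Γ₂) ≤ t·L(Γ₁) + (1−t)·L(Γ₂), where arithmetic is in [0,+∞] with 0·(+∞) = 0. Then for every Γ in the intrinsic interior (relative interior) of the set { Γ' : L(Γ') < +∞ }, the Lagrange dual attains the primal value: the supremum over λ : ι → ℝ of the infimum over x ∈ D of ( f(x) − Σ_{i∈ι} λ_i·(g(x)_i − Γ_i) ), computed in the extended reals, equals L(Γ). -/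
open scoped ENNReal

/-- A convex function on a real vector space has a subgradient at every algebraic interior point
of its domain. -/
theorem ConvexOn.exists_subgradient_of_absorbing {E : Type*} [AddCommGroup E] [Module ℝ E]
    {s : Set E} {h : E → ℝ} (hh : ConvexOn ℝ s h) {x : E}
    (hx : ∀ v : E, ∃ t : ℝ, 0 < t ∧ x + t • v ∈ s) :
    ∃ φ : E →ₗ[ℝ] ℝ, ∀ y ∈ s, h x + φ (y - x) ≤ h y := by
  have hxs : x ∈ s := by
    obtain ⟨t, -, ht⟩ := hx 0
    simpa using ht
  let K : PointedCone ℝ (E × ℝ) :=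
    { carrier := {p | ∃ t : ℝ, 0 < t ∧ x + t • p.1 ∈ s ∧ h (x + t • p.1) ≤ h x + t * p.2}
      zero_mem' := ⟨1, one_pos, by simpa using hxs, by simp⟩
      add_mem' := by
        rintro ⟨v, a⟩ ⟨w, b⟩ ⟨t, ht, hts, htb⟩ ⟨u, hu, hus, hub⟩
        have htu : 0 < t + u := add_pos ht hu
        have hsum : u / (t + u) + t / (t + u) = 1 := by field_simp; ring
        have hpt : x + (t * u / (t + u)) • (v + w)
            = (u / (t + u)) • (x + t • v) + (t / (t + u)) • (x + u • w) := by
          have hc : x = (u / (t + u) + t / (t + u)) • x := by rw [hsum, one_smul]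
          nth_rewrite 1 [hc]
          module
        refine ⟨t * u / (t + u), by positivity, ?_, ?_⟩
        · simp only [Prod.fst_add]
          rw [hpt]
          exact hh.1 hts hus (by positivity) (by positivity) hsum
        · simp only [Prod.fst_add, Prod.snd_add]
          rw [hpt]
          calc _ ≤ (u / (t + u)) • h (x + t • v) + (t / (t + u)) • h (x + u • w) :=
                hh.2 hts hus (by positivity) (by positivity) hsum
            _ ≤ (u / (t + u)) * (h x + t * a) + (t / (t + u)) * (h x + u * b) := by
                simp only [smul_eq_mul]
                gcongr
            _ = h x + t * u / (t + u) * (a + b) := by field_simp; ring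
      smul_mem' := by
        rintro ⟨c, hc⟩ ⟨v, a⟩ ⟨t, ht, hts, htb⟩
        rcases eq_or_lt_of_le' hc with rfl | hc
        · exact ⟨1, one_pos, by simpa using hxs, by simp⟩
        · have hv : (t / c) • c • v = t • v := by rw [smul_smul, div_mul_cancel₀ _ hc.ne']
          have ha : t / c * (c * a) = t * a := by field_simp
          refine ⟨t / c, div_pos ht hc, ?_, ?_⟩
          · change x + (t / c) • c • v ∈ s
            rwa [hv]
          · change h (x + (t / c) • c • v) ≤ h x + t / c * (c * a)
            rwa [hv, ha] }
  let f : E × ℝ →ₗ.[ℝ] ℝ :=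
    ⟨Submodule.prod ⊥ ⊤, (LinearMap.snd ℝ E ℝ).domRestrict _⟩
  obtain ⟨ψ, hψf, hψK⟩ := riesz_extension K f
    (by
      rintro ⟨⟨v, a⟩, hv, _⟩ ⟨t, ht, -, hle⟩
      obtain rfl : v = 0 := hv
      change 0 ≤ a
      have hta : 0 ≤ t * a := by simpa using hle
      exact nonneg_of_mul_nonneg_right hta ht)
    (by
      rintro ⟨v, a⟩
      obtain ⟨t, ht, hts⟩ := hx v
      refine ⟨⟨(0, (h (x + t • v) - h x) / t - a), by simp [f]⟩, t, ht, ?_, ?_⟩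
      · simpa using hts
      · simp [mul_div_cancel₀ _ ht.ne'])
  refine ⟨-(ψ.comp (LinearMap.inl ℝ E ℝ)), fun y hy => ?_⟩
  have hmem : ((y - x, h y - h x) : E × ℝ) ∈ K := ⟨1, one_pos, by simpa using hy, by simp⟩
  have hsnd : ψ (0, h y - h x) = h y - h x := hψf ⟨(0, h y - h x), by simp [f]⟩
  have hsplit : ψ (y - x, h y - h x) = ψ (y - x, 0) + ψ (0, h y - h x) := by
    rw [← map_add]; simp
  have hnonneg := hψK _ hmem
  simp only [LinearMap.neg_apply, LinearMap.comp_apply, LinearMap.inl_apply]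
  linarith

/-- A convex function has a subgradient at every point of the relative interior of its domain. -/
theorem ConvexOn.exists_subgradient_of_mem_intrinsicInterior {E : Type*} [AddCommGroup E]
    [Module ℝ E] [TopologicalSpace E] [ContinuousAdd E] [ContinuousSMul ℝ E]
    {s : Set E} {h : E → ℝ} (hh : ConvexOn ℝ s h) {x : E} (hx : x ∈ intrinsicInterior ℝ s) :
    ∃ φ : E →ₗ[ℝ] ℝ, ∀ y ∈ s, h x + φ (y - x) ≤ h y := by
  obtain ⟨z, hz, rfl⟩ := mem_intrinsicInterior.1 hx
  let T : vectorSpan ℝ s →ᵃ[ℝ] E :=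
    (vectorSpan ℝ s).subtype.toAffineMap + AffineMap.const ℝ _ (z : E)
  have hT : ∀ v, T v = v + z := fun v => rfl
  have habs : ∀ v : vectorSpan ℝ s, ∃ t : ℝ, 0 < t ∧ 0 + t • v ∈ T ⁻¹' s := by
    intro v
    have hmem : ∀ t : ℝ, ((t • v : vectorSpan ℝ s) : E) + z ∈ affineSpan ℝ s := fun t =>
      AffineSubspace.vadd_mem_of_mem_direction
        (by rw [direction_affineSpan]; exact (t • v).2) z.2
    let γ : ℝ → affineSpan ℝ s := fun t => ⟨((t • v : vectorSpan ℝ s) : E) + z, hmem t⟩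
    have hγ : Continuous γ := by
      refine Continuous.subtype_mk ?_ _
      simp only [Submodule.coe_smul]
      fun_prop
    have hγ0 : γ 0 = z := by ext; simp [γ]
    have hev : ∀ᶠ t in nhds (0 : ℝ), γ t ∈ ((↑) ⁻¹' s : Set (affineSpan ℝ s)) :=
      hγ.continuousAt.eventually (by rw [hγ0]; exact mem_interior_iff_mem_nhds.1 hz)
    obtain ⟨t, hts, ht⟩ :=
      ((hev.filter_mono nhdsWithin_le_nhds).and (self_mem_nhdsWithin (s := Set.Ioi (0 : ℝ)))).exists
    exact ⟨t, ht, by simpa [hT, γ] using hts⟩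
  obtain ⟨φ, hφ⟩ := (hh.comp_affineMap T).exists_subgradient_of_absorbing habs
  obtain ⟨φ', rfl⟩ := φ.exists_extend
  refine ⟨φ', fun y hy => ?_⟩
  have hv : y - z ∈ vectorSpan ℝ s :=
    vsub_mem_vectorSpan ℝ hy (intrinsicInterior_subset hx)
  simpa [hT, hy] using hφ ⟨y - z, hv⟩ (by simpa [hT] using hy)

/-- Real-valued form of convexity for an extended nonnegative function, on its domain. -/
theorem ENNReal.convexOn_toReal {E : Type*} [AddCommGroup E] [Module ℝ E] {L : E → ℝ≥0∞}
    (hconv : ∀ x y : E, ∀ t ∈ Set.Icc (0 : ℝ) 1,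
      L (t • x + (1 - t) • y) ≤ ENNReal.ofReal t * L x + ENNReal.ofReal (1 - t) * L y) :
    ConvexOn ℝ {x | L x < ⊤} fun x => (L x).toReal := by
  have key : ∀ {x y : E}, L x < ⊤ → L y < ⊤ → ∀ {a b : ℝ}, 0 ≤ a → 0 ≤ b → a + b = 1 →
      L (a • x + b • y) ≤ ENNReal.ofReal (a * (L x).toReal + b * (L y).toReal) := by
    intro x y hx hy a b ha hb hab
    obtain rfl : b = 1 - a := by linarith
    refine (hconv x y a ⟨ha, by linarith⟩).trans_eq ?_
    rw [ENNReal.ofReal_add (by positivity) (by positivity), ENNReal.ofReal_mul ha,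
      ENNReal.ofReal_mul hb, ENNReal.ofReal_toReal hx.ne, ENNReal.ofReal_toReal hy.ne]
  refine ⟨fun x hx y hy a b ha hb hab => (key hx hy ha hb hab).trans_lt ENNReal.ofReal_lt_top,
    fun x hx y hy a b ha hb hab => ?_⟩
  exact ENNReal.toReal_le_of_le_ofReal (by positivity) (key hx hy ha hb hab)

/-- Strong Lagrange duality on the relative interior of the domain of the (convex)
value function `L(Γ) := inf { f(x) : x ∈ D, g(x) = Γ }` (with `inf ∅ = +∞`). -/
theorem stmt_0 {D : Type*} [Nonempty D] {ι : Type*} [Fintype ι]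
    (f : D → ℝ) (hf : ∀ x, 0 ≤ f x) (g : D → ι → ℝ)
    (L : (ι → ℝ) → ℝ≥0∞)
    (hL : ∀ Γ : ι → ℝ, L Γ = ⨅ x : {x : D // g x = Γ}, ENNReal.ofReal (f x.1))
    (hconv : ∀ Γ₁ Γ₂ : ι → ℝ, ∀ t ∈ Set.Icc (0 : ℝ) 1,
      L (t • Γ₁ + (1 - t) • Γ₂) ≤ ENNReal.ofReal t * L Γ₁ + ENNReal.ofReal (1 - t) * L Γ₂)
    (Γ : ι → ℝ) (hΓ : Γ ∈ intrinsicInterior ℝ {Γ' : ι → ℝ | L Γ' < ⊤}) :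
    (⨆ lam : ι → ℝ, ⨅ x : D,
        ((f x - ∑ i, lam i * (g x i - Γ i) : ℝ) : EReal)) = (L Γ : EReal) := by
  classical
  have hfin : L Γ < ⊤ := (intrinsicInterior_subset hΓ : Γ ∈ {Γ' | L Γ' < ⊤})
  have hle : ∀ x, L (g x) ≤ ENNReal.ofReal (f x) := fun x => by
    rw [hL]
    exact iInf_le (fun y : {y : D // g y = g x} => ENNReal.ofReal (f y.1)) ⟨x, rfl⟩
  rw [← EReal.coe_ennreal_toReal hfin.ne]
  apply le_antisymm
  · refine iSup_le fun lam => EReal.le_of_forall_lt_iff_le.1 fun r hr => ?_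
    have hr' : L Γ < ENNReal.ofReal r :=
      (ENNReal.lt_ofReal_iff_toReal_lt hfin.ne).2 (EReal.coe_lt_coe_iff.1 hr)
    rw [hL, iInf_lt_iff] at hr'
    obtain ⟨⟨x, rfl⟩, hx⟩ := hr'
    refine (iInf_le _ x).trans (EReal.coe_le_coe_iff.2 ?_)
    simpa using (ENNReal.ofReal_lt_ofReal_iff'.1 hx).1.le
  · obtain ⟨φ, hφ⟩ :=
      (ENNReal.convexOn_toReal hconv).exists_subgradient_of_mem_intrinsicInterior hΓ
    refine le_iSup_of_le (fun i => φ fun j => if i = j then 1 else 0) (le_iInf fun x => ?_)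
    rw [EReal.coe_le_coe_iff]
    have hsub := hφ (g x) ((hle x).trans_lt ENNReal.ofReal_lt_top)
    have hval := ENNReal.toReal_le_of_le_ofReal (hf x) (hle x)
    have hsum := LinearMap.pi_apply_eq_sum_univ φ (g x - Γ)
    simp only [smul_eq_mul, Pi.sub_apply, mul_comm (g x _ - Γ _)] at hsum
    linarith
end

section
/- No-signalling attack on the magic-square game: for every input pair (x⋆,y⋆) ∈ {0,1,2}×{0,1,2} there exist a finite nonempty set Λ, a probability distribution w on Λ, and a family (P_λ)_{λ∈Λ} of bipartite conditional distributions with inputs x,y ∈ {0,1,2} and outputs a,b ∈ {0,1}³ such that: (i) each P_λ satisfies the no-signalling conditions; (ii) each P_λ perfectly wins the magic-square game, i.e. P_λ(a,b|x,y) = 0 whenever a does not have even parity, or b does not have odd parity, or a_y ≠ b_x; (iii) P_λ(a,b|x⋆,y⋆) ∈ {0,1} for all λ, a, b; and (iv) the averaged distribution satisfies Σ_{λ∈Λ} w(λ)·P_λ(a,b|x,y) ≤ 1/2 for all a, b, x, y. -/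
/-- The value `t` on every position except `j + 1`, where it is `false`: an even-parity string
with entry `t` at position `j`. -/
def evenString (t : Bool) (j : Fin 3) : Fin 3 → Bool :=
  fun k => t && decide (k ≠ j + 1)

/-- An odd-parity string with entry `t` at position `i`. -/
def oddString (t : Bool) (i : Fin 3) : Fin 3 → Bool :=
  fun k => if k = i then t else if k = i + 1 then !t else false

/-- Twice the probabilities of a box that fixes row `xs` to `evenString t ys` and column `ys` to
`oddString t xs`, and acts as a Popescu-Rohrlich box on the remaining four cells. -/
def boxWeight (t : Bool) (xs ys x y : Fin 3) (a b : Fin 3 → Bool) : ℕ :=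
  if xor (a 0) (xor (a 1) (a 2)) = false ∧ xor (b 0) (xor (b 1) (b 2)) = true ∧ a y = b x ∧
      a ys = oddString t xs x ∧ b xs = evenString t ys y ∧
      (x = xs → a = evenString t ys) ∧ (y = ys → b = oddString t xs)
  then (if x = xs ∧ y = ys then 2 else 1) else 0

theorem boxWeight_sum_eq_two : ∀ (t : Bool) (xs ys x y : Fin 3),
    ∑ a, ∑ b, boxWeight t xs ys x y a b = 2 := by
  decide +kernel

theorem boxWeight_noSignalling_left : ∀ (t : Bool) (xs ys : Fin 3) (a : Fin 3 → Bool)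
    (x y y' : Fin 3),
    ∑ b, boxWeight t xs ys x y a b = ∑ b, boxWeight t xs ys x y' a b := by
  decide +kernel

theorem boxWeight_noSignalling_right : ∀ (t : Bool) (xs ys : Fin 3) (b : Fin 3 → Bool)
    (y x x' : Fin 3),
    ∑ a, boxWeight t xs ys x y a b = ∑ a, boxWeight t xs ys x' y a b := by
  decide +kernel

theorem boxWeight_eq_zero (t : Bool) (xs ys x y : Fin 3) (a b : Fin 3 → Bool)
    (h : xor (a 0) (xor (a 1) (a 2)) = true ∨
      xor (b 0) (xor (b 1) (b 2)) = false ∨ a y ≠ b x) :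
    boxWeight t xs ys x y a b = 0 := by
  refine if_neg fun ⟨h1, h2, h3, _⟩ => ?_
  simp [h1, h2, h3] at h

theorem boxWeight_self (t : Bool) (xs ys : Fin 3) (a b : Fin 3 → Bool) :
    boxWeight t xs ys xs ys a b = 0 ∨ boxWeight t xs ys xs ys a b = 2 := by
  unfold boxWeight
  split_ifs <;> simp_all

theorem evenString_injective (j : Fin 3) : Function.Injective (evenString · j) := by
  intro s t h
  simpa [evenString] using congrFun h j

theorem boxWeight_add_le_two (xs ys x y : Fin 3) (a b : Fin 3 → Bool) :
    boxWeight false xs ys x y a b + boxWeight true xs ys x y a b ≤ 2 := by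
  unfold boxWeight
  by_cases hxy : x = xs ∧ y = ys
  · by_cases ha : a = evenString true ys
    · have : a ≠ evenString false ys := fun h =>
        Bool.false_ne_true (evenString_injective ys (h.symm.trans ha))
      rw [if_neg (fun h => this (h.2.2.2.2.2.1 hxy.1))]
      split_ifs <;> omega
    · rw [if_neg (c := _ ∧ _ ∧ _ ∧ _ = oddString true _ _ ∧ _)
        (fun h => ha (h.2.2.2.2.2.1 hxy.1))]
      split_ifs <;> omega
  · simp only [if_neg hxy]
    split_ifs <;> omega


/-- No-signalling attack on the magic-square game: for every input pair there is a
no-signalling hidden-variable strategy that perfectly wins the magic-square game, is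
deterministic on the chosen input pair, and whose averaged distribution has all
probabilities at most `1/2`. -/
theorem stmt_8 (xs ys : Fin 3) :
    ∃ m : ℕ, 0 < m ∧
      ∃ (w : Fin m → ℝ)
        (P : Fin m → Fin 3 → Fin 3 → (Fin 3 → Bool) → (Fin 3 → Bool) → ℝ),
        (∀ l, 0 ≤ w l) ∧ (∑ l, w l = 1) ∧
        (∀ l x y a b, 0 ≤ P l x y a b) ∧
        (∀ l x y, ∑ a, ∑ b, P l x y a b = 1) ∧
        -- no-signalling conditions for each hidden variable
        (∀ l (a : Fin 3 → Bool) (x y y' : Fin 3),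
          ∑ b, P l x y a b = ∑ b, P l x y' a b) ∧
        (∀ l (b : Fin 3 → Bool) (y x x' : Fin 3),
          ∑ a, P l x y a b = ∑ a, P l x' y a b) ∧
        -- each P_λ perfectly wins the magic-square game
        (∀ l x y a b,
          (xor (a 0) (xor (a 1) (a 2)) = true ∨
            xor (b 0) (xor (b 1) (b 2)) = false ∨ a y ≠ b x) →
          P l x y a b = 0) ∧
        -- deterministic outputs on the input pair (xs, ys)
        (∀ l a b, P l xs ys a b = 0 ∨ P l xs ys a b = 1) ∧
        -- the averaged distribution hides the attack
        (∀ a b x y, ∑ l, w l * P l x y a b ≤ 1 / 2) := by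
  refine ⟨2, two_pos, fun _ => 1 / 2,
    fun l x y a b => (boxWeight (decide (l = 1)) xs ys x y a b : ℝ) / 2,
    fun _ => by norm_num, by norm_num, fun l x y a b => by positivity, ?_, ?_, ?_, ?_, ?_, ?_⟩
  · intro l x y
    have h := boxWeight_sum_eq_two (decide (l = 1)) xs ys x y
    simp only [← Finset.sum_div]
    rw [div_eq_one_iff_eq two_ne_zero]
    exact_mod_cast h
  · intro l a x y y'
    simp only [← Finset.sum_div]
    congr 1
    exact_mod_cast boxWeight_noSignalling_left (decide (l = 1)) xs ys a x y y'
  · intro l b y x x'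
    simp only [← Finset.sum_div]
    congr 1
    exact_mod_cast boxWeight_noSignalling_right (decide (l = 1)) xs ys b y x x'
  · intro l x y a b h
    simp [boxWeight_eq_zero _ xs ys x y a b h]
  · intro l a b
    rcases boxWeight_self (decide (l = 1)) xs ys a b with h | h <;> simp [h]
  · intro a b x y
    have h : (boxWeight false xs ys x y a b : ℝ) + boxWeight true xs ys x y a b ≤ 2 := by
      exact_mod_cast boxWeight_add_le_two xs ys x y a b
    simp only [Fin.sum_univ_two, zero_ne_one, decide_false, decide_true]
    linarith
end

section
/- The canonical quantum magic-square distribution admits a no-signalling hidden-variable model that is deterministic on any chosen input pair: let P₀ be the bipartite conditional distribution with inputs x,y ∈ {0,1,2} and outputs a,b ∈ {0,1}³ defined by P₀(a,b|x,y) = 1/8 if a has even parity, b has odd parity, and a_y = b_x, and P₀(a,b|x,y) = 0 otherwise. Then for every input pair (x⋆,y⋆) ∈ {0,1,2}×{0,1,2} there exist a finite nonempty set Λ, a probability distribution w on Λ, and a family (P_λ)_{λ∈Λ} of bipartite conditional distributions, each satisfying the no-signalling conditions, such that Σ_{λ∈Λ} w(λ)·P_λ(a,b|x,y) = P₀(a,b|x,y)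 for all a, b, x, y, and P_λ(a,b|x⋆,y⋆) ∈ {0,1} for all λ, a, b. -/
/-- The winning condition of the magic-square game. -/
abbrev MagicWin (x y : Fin 3) (a b : Fin 3 → Bool) : Prop :=
  xor (a 0) (xor (a 1) (a 2)) = false ∧ xor (b 0) (xor (b 1) (b 2)) = true ∧ a y = b x

/-- Cyclic shift of an output string. -/
def cyclicShift (i : Fin 3) : (Fin 3 → Bool) ≃ (Fin 3 → Bool) :=
  (Equiv.addLeft i).symm.arrowCongr (Equiv.refl Bool)

lemma cyclicShift_apply (i j : Fin 3) (a : Fin 3 → Bool) : cyclicShift i a j = a (i + j) := rfl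

lemma xor_cyclicShift : ∀ (i : Fin 3) (a : Fin 3 → Bool),
    xor (cyclicShift i a 0) (xor (cyclicShift i a 1) (cyclicShift i a 2)) =
      xor (a 0) (xor (a 1) (a 2)) := by
  decide +kernel

lemma magicWin_cyclicShift (i j x y : Fin 3) (a b : Fin 3 → Bool) :
    MagicWin (x - i) (y - j) (cyclicShift j a) (cyclicShift i b) ↔ MagicWin x y a b := by
  rw [MagicWin, xor_cyclicShift, xor_cyclicShift, cyclicShift_apply, cyclicShift_apply,
    add_sub_cancel, add_sub_cancel]

/-- Twice the response probability of the hidden variable `(s, t)`, the pair of outputs that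
is produced deterministically on the input pair `(0, 0)`. -/
def magicResponse (s t : Fin 3 → Bool) (x y : Fin 3) (a b : Fin 3 → Bool) : ℕ :=
  if MagicWin x y a b ∧ a 0 = t x ∧ b 0 = s y ∧ (x = 0 → a = s) ∧ (y = 0 → b = t) then
    if x = 0 ∧ y = 0 then 2 else 1
  else 0

/-- Twice Alice's marginal of `magicResponse`. -/
def magicMarginalLeft (s t : Fin 3 → Bool) (x : Fin 3) (a : Fin 3 → Bool) : ℕ :=
  if xor (a 0) (xor (a 1) (a 2)) = false ∧ a 0 = t x ∧ (x = 0 → a = s) then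
    if x = 0 then 2 else 1
  else 0

/-- Twice Bob's marginal of `magicResponse`. -/
def magicMarginalRight (s t : Fin 3 → Bool) (y : Fin 3) (b : Fin 3 → Bool) : ℕ :=
  if xor (b 0) (xor (b 1) (b 2)) = true ∧ b 0 = s y ∧ (y = 0 → b = t) then
    if y = 0 then 2 else 1
  else 0

lemma sum_magicResponse_right : ∀ (s t : Fin 3 → Bool), MagicWin 0 0 s t →
    ∀ (x y : Fin 3) (a : Fin 3 → Bool),
      ∑ b, magicResponse s t x y a b = magicMarginalLeft s t x a := by
  decide +kernel

lemma sum_magicResponse_left : ∀ (s t : Fin 3 → Bool), MagicWin 0 0 s t →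
    ∀ (x y : Fin 3) (b : Fin 3 → Bool),
      ∑ a, magicResponse s t x y a b = magicMarginalRight s t y b := by
  decide +kernel

lemma sum_magicMarginalLeft : ∀ (s t : Fin 3 → Bool), MagicWin 0 0 s t →
    ∀ x : Fin 3, ∑ a, magicMarginalLeft s t x a = 2 := by
  decide +kernel

lemma card_magicWin :
    Fintype.card {p : (Fin 3 → Bool) × (Fin 3 → Bool) // MagicWin 0 0 p.1 p.2} = 8 := by
  decide +kernel

lemma sum_magicResponse : ∀ (x y : Fin 3) (a b : Fin 3 → Bool),
    ∑ p : {p : (Fin 3 → Bool) × (Fin 3 → Bool) // MagicWin 0 0 p.1 p.2},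
      magicResponse p.1.1 p.1.2 x y a b = if MagicWin x y a b then 2 else 0 := by
  decide +kernel

lemma magicResponse_zero_zero (s t a b : Fin 3 → Bool) :
    magicResponse s t 0 0 a b = 0 ∨ magicResponse s t 0 0 a b = 2 := by
  unfold magicResponse
  split_ifs <;> simp_all


/-- The canonical quantum magic-square distribution admits a no-signalling
hidden-variable model that is deterministic on any chosen input pair. -/
theorem stmt_9 (P₀ : Fin 3 → Fin 3 → (Fin 3 → Bool) → (Fin 3 → Bool) → ℝ)
    (hP₀ : ∀ x y a b, P₀ x y a b =
      if xor (a 0) (xor (a 1) (a 2)) = false ∧ xor (b 0) (xor (b 1) (b 2)) = true ∧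
          a y = b x
      then 1 / 8 else 0)
    (xs ys : Fin 3) :
    ∃ m : ℕ, 0 < m ∧
      ∃ (w : Fin m → ℝ)
        (P : Fin m → Fin 3 → Fin 3 → (Fin 3 → Bool) → (Fin 3 → Bool) → ℝ),
        (∀ l, 0 ≤ w l) ∧ (∑ l, w l = 1) ∧
        (∀ l x y a b, 0 ≤ P l x y a b) ∧
        (∀ l x y, ∑ a, ∑ b, P l x y a b = 1) ∧
        -- no-signalling conditions for each hidden variable
        (∀ l (a : Fin 3 → Bool) (x y y' : Fin 3),
          ∑ b, P l x y a b = ∑ b, P l x y' a b) ∧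
        (∀ l (b : Fin 3 → Bool) (y x x' : Fin 3),
          ∑ a, P l x y a b = ∑ a, P l x' y a b) ∧
        -- the model reproduces the canonical distribution
        (∀ x y a b, ∑ l, w l * P l x y a b = P₀ x y a b) ∧
        -- deterministic outputs on the input pair (xs, ys)
        (∀ l a b, P l xs ys a b = 0 ∨ P l xs ys a b = 1) := by
  let e := (Fintype.equivFinOfCardEq card_magicWin).symm
  let R (l : Fin 8) (x y : Fin 3) (a b : Fin 3 → Bool) : ℝ :=
    magicResponse (e l).1.1 (e l).1.2 (x - xs) (y - ys) (cyclicShift ys a) (cyclicShift xs b)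
  have hright (l : Fin 8) (x y : Fin 3) (a : Fin 3 → Bool) :
      ∑ b, R l x y a b / 2 =
        (magicMarginalLeft (e l).1.1 (e l).1.2 (x - xs) (cyclicShift ys a) : ℝ) / 2 := by
    rw [← Finset.sum_div, ← sum_magicResponse_right _ _ (e l).2 (x - xs) (y - ys),
      Nat.cast_sum]
    exact congrArg (· / 2) ((cyclicShift xs).sum_comp fun b =>
      (magicResponse (e l).1.1 (e l).1.2 (x - xs) (y - ys) (cyclicShift ys a) b : ℝ))
  have hleft (l : Fin 8) (x y : Fin 3) (b : Fin 3 → Bool) :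
      ∑ a, R l x y a b / 2 =
        (magicMarginalRight (e l).1.1 (e l).1.2 (y - ys) (cyclicShift xs b) : ℝ) / 2 := by
    rw [← Finset.sum_div, ← sum_magicResponse_left _ _ (e l).2 (x - xs) (y - ys),
      Nat.cast_sum]
    exact congrArg (· / 2) ((cyclicShift ys).sum_comp fun a =>
      (magicResponse (e l).1.1 (e l).1.2 (x - xs) (y - ys) a (cyclicShift xs b) : ℝ))
  refine ⟨8, by norm_num, fun _ => 1 / 8, fun l x y a b => R l x y a b / 2,
    fun _ => by norm_num, by norm_num, fun l x y a b => by positivity, fun l x y => ?_,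
    fun l a x y y' => by simp only [hright], fun l b y x x' => by simp only [hleft],
    fun x y a b => ?_, fun l a b => ?_⟩
  · simp only [hright]
    rw [(cyclicShift ys).sum_comp fun a =>
        (magicMarginalLeft (e l).1.1 (e l).1.2 (x - xs) a : ℝ) / 2,
      ← Finset.sum_div, ← Nat.cast_sum, sum_magicMarginalLeft _ _ (e l).2]
    norm_num
  · rw [← Finset.mul_sum, ← Finset.sum_div, e.sum_comp (fun p =>
      (magicResponse p.1.1 p.1.2 (x - xs) (y - ys) (cyclicShift ys a) (cyclicShift xs b) : ℝ)),
      ← Nat.cast_sum, sum_magicResponse, hP₀]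
    simp only [magicWin_cyclicShift]
    split_ifs <;> norm_num
  · rcases magicResponse_zero_zero (e l).1.1 (e l).1.2 (cyclicShift ys a) (cyclicShift xs b)
      with h | h <;> simp [R, h]
end

section
/- Let h denote the binary entropy function h(x) = −x·ln x − (1−x)·ln(1−x) (natural logarithm, with h(0) = 0). Then the limit, as δ → 0 from above, of ( −δ − (1+δ)·h(δ/(1+δ)) ) / h(δ) equals −1. -/
open Real Filter

lemma one_add_mul_binEntropy_div_one_add {x : ℝ} (hx : 0 < x) :
    (1 + x) * binEntropy (x / (1 + x)) = (1 + x) * log (1 + x) - x * log x := by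
  have h : (1 + x) ≠ 0 := by positivity
  have h' : 1 - x / (1 + x) = (1 + x)⁻¹ := by field_simp; ring
  rw [binEntropy, h', inv_inv, log_inv, log_div hx.ne' h]
  field_simp
  ring

lemma mul_neg_log_le_binEntropy {x : ℝ} (hx0 : 0 ≤ x) (hx1 : x ≤ 1) :
    x * -log x ≤ binEntropy x := by
  rw [binEntropy, log_inv, log_inv]
  nlinarith [log_nonpos (sub_nonneg.2 hx1) (by linarith : 1 - x ≤ 1)]

lemma abs_neg_sub_one_add_mul_binEntropy_div_add_one_le {x : ℝ} (hx0 : 0 < x) (hx1 : x < 1) :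
    |(-x - (1 + x) * binEntropy (x / (1 + x))) / binEntropy x + 1| ≤ 3 * (-log x)⁻¹ := by
  have hb : 0 < binEntropy x := binEntropy_pos hx0 hx1
  have hl : 0 < -log x := neg_pos.2 (log_neg hx0 hx1)
  have hN : |-x - (1 + x) * binEntropy (x / (1 + x)) + binEntropy x| ≤ 3 * x := by
    rw [one_add_mul_binEntropy_div_one_add hx0, binEntropy, log_inv, log_inv]
    have h1 : 0 ≤ log (1 + x) := log_nonneg (by linarith)
    have h2 : log (1 + x) ≤ x := by
      linarith [log_le_sub_one_of_pos (by linarith : 0 < 1 + x)]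
    have h3 : log (1 - x) ≤ 0 := log_nonpos (by linarith) (by linarith)
    have h4 : -x ≤ (1 - x) * log (1 - x) := by
      have h := mul_le_mul_of_nonneg_left (one_sub_inv_le_log_of_pos (sub_pos.2 hx1))
        (sub_pos.2 hx1).le
      rw [mul_sub, mul_inv_cancel₀ (sub_pos.2 hx1).ne'] at h
      linarith
    rw [abs_le]
    constructor <;> nlinarith
  rw [div_add_one hb.ne', abs_div, abs_of_pos hb, div_le_iff₀ hb]
  calc _ ≤ 3 * x := hN
    _ = 3 * (-log x)⁻¹ * (x * -log x) := by
      rw [mul_comm x, mul_assoc, inv_mul_cancel_left₀ hl.ne']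
    _ ≤ 3 * (-log x)⁻¹ * binEntropy x := by
      gcongr
      exact mul_neg_log_le_binEntropy hx0.le hx1.le

/-- The continuity-bound corrections in the advantage-distillation security proof
contribute exactly `-1` to the entropy ratio in the large-block limit. -/
theorem stmt_10 :
    Tendsto (fun δ : ℝ => (-δ - (1 + δ) * binEntropy (δ / (1 + δ))) / binEntropy δ)
      (nhdsWithin 0 (Set.Ioi 0)) (nhds (-1)) := by
  have hlim : Tendsto (fun δ : ℝ => 3 * (-log δ)⁻¹) (nhdsWithin 0 (Set.Ioi 0)) (nhds 0) := by
    simpa using (tendsto_neg_atBot_atTop.comp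
      tendsto_log_nhdsGT_zero).inv_tendsto_atTop.const_mul 3
  rw [tendsto_iff_norm_sub_tendsto_zero]
  refine squeeze_zero' (Eventually.of_forall fun _ => norm_nonneg _) ?_ hlim
  filter_upwards [Ioo_mem_nhdsGT (zero_lt_one' ℝ)] with x hx
  rw [sub_neg_eq_add, norm_eq_abs]
  exact abs_neg_sub_one_add_mul_binEntropy_div_add_one_le hx.1 hx.2
end

section
/- Let h denote the binary entropy function h(x) = −x·ln x − (1−x)·ln(1−x) (natural logarithm, with h(0) = 0). For every ε ∈ (0,1/2) and every real α with ε/(1−ε) < α, setting δ_k := ε^k / (ε^k + (1−ε)^k), the sequence k ↦ α^k / h(δ_k) tends to +∞ as k → ∞. -/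
open Real Filter

lemma binEntropy_div_one_add {x : ℝ} (hx : 0 < x) :
    binEntropy (x / (1 + x)) = log (1 + x) - x / (1 + x) * log x := by
  have h1 : 1 + x ≠ 0 := by positivity
  have h2 : 1 - x / (1 + x) = (1 + x)⁻¹ := by field_simp; ring
  rw [binEntropy, h2, log_inv, log_inv, log_inv, log_div hx.ne' h1]
  field_simp
  ring

lemma binEntropy_div_one_add_le {x : ℝ} (hx : 0 < x) (hx1 : x ≤ 1) :
    binEntropy (x / (1 + x)) ≤ x * (1 - log x) := by
  have h1 : log (1 + x) ≤ x := by linarith [log_le_sub_one_of_pos (by positivity : 0 < 1 + x)]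
  have h2 : x / (1 + x) ≤ x := div_le_self hx.le (by linarith)
  rw [binEntropy_div_one_add hx]
  nlinarith [log_nonpos hx.le hx1]

/-- Divergence of `α^k / h(δ_k)` with `δ_k = ε^k/(ε^k + (1-ε)^k)`, whenever
`α > ε/(1-ε)`: the key step for positivity of the advantage-distillation keyrate. -/
theorem stmt_11 (ε : ℝ) (hε : ε ∈ Set.Ioo (0 : ℝ) (1 / 2)) (α : ℝ)
    (hα : ε / (1 - ε) < α) :
    Tendsto (fun k : ℕ => α ^ k / binEntropy (ε ^ k / (ε ^ k + (1 - ε) ^ k)))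
      atTop atTop := by
  obtain ⟨h0, h1⟩ := hε
  have hε' : 0 < 1 - ε := by linarith
  set r := ε / (1 - ε) with hr
  have hr0 : 0 < r := div_pos h0 hε'
  have hr1 : r < 1 := (div_lt_one hε').2 (by linarith)
  have hα0 : 0 < α := hr0.trans hα
  have hδ (k : ℕ) : ε ^ k / (ε ^ k + (1 - ε) ^ k) = r ^ k / (1 + r ^ k) := by
    rw [hr, div_pow]
    field_simp
    ring
  have hq0 : 0 ≤ r / α := by positivity
  have hq1 : r / α < 1 := (div_lt_one hα0).2 hα
  have hpos (k : ℕ) : 0 < binEntropy (r ^ k / (1 + r ^ k)) / α ^ k := by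
    have hx : 0 < r ^ k := by positivity
    have hden : 0 < 1 + r ^ k := by positivity
    exact div_pos (binEntropy_pos (by positivity) ((div_lt_one hden).2 (by linarith)))
      (by positivity)
  have hbound (k : ℕ) : binEntropy (r ^ k / (1 + r ^ k)) / α ^ k ≤
      (r / α) ^ k - log r * (k * (r / α) ^ k) := by
    have hle := binEntropy_div_one_add_le (pow_pos hr0 k) (pow_le_one₀ hr0.le hr1.le)
    rw [log_pow] at hle
    calc _ ≤ r ^ k * (1 - k * log r) / α ^ k := by gcongr
      _ = _ := by rw [div_pow]; ring
  have hlim : Tendsto (fun k : ℕ => (r / α) ^ k - log r * (k * (r / α) ^ k)) atTop (nhds 0) := by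
    simpa using (tendsto_pow_atTop_nhds_zero_of_lt_one hq0 hq1).sub
      ((tendsto_self_mul_const_pow_of_lt_one hq0 hq1).const_mul (log r))
  have hzero := squeeze_zero (fun k => (hpos k).le) hbound hlim
  have hinv := (tendsto_nhdsWithin_iff.2
    ⟨hzero, Eventually.of_forall fun k => Set.mem_Ioi.2 (hpos k)⟩).inv_tendsto_nhdsGT_zero
  refine hinv.congr fun k => ?_
  rw [hδ, Pi.inv_apply, inv_div]
end

section
/- Let h denote the binary entropy function h(x) = −x·ln x − (1−x)·ln(1−x) (natural logarithm, with h(0) = h(1) = 0). For every p ∈ [0,1]: h((1−p)/2) ≤ ln 2 − p²/2. Equivalently, in base 2, h₂((1−p)/2) ≤ 1 − p²/ln 4. -/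
open Real

theorem two_mul_le_log_one_add_sub_log_one_sub {x : ℝ} (h₀ : 0 ≤ x) (h₁ : x < 1) :
    2 * x ≤ log (1 + x) - log (1 - x) := by
  have h := hasSum_log_sub_log_of_abs_lt_one (abs_lt.mpr ⟨by linarith, h₁⟩)
  simpa using le_hasSum h 0 fun k _ => by positivity

theorem antitoneOn_binEntropy_add_sq_div_two :
    AntitoneOn (fun x : ℝ => binEntropy ((1 - x) / 2) + x ^ 2 / 2) (Set.Icc 0 1) := by
  refine antitoneOn_of_hasDerivWithinAt_nonpos (convex_Icc 0 1)
    (f' := fun x => (log (1 - (1 - x) / 2) - log ((1 - x) / 2)) * (-1 / 2) + x)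
    (by fun_prop) (fun x hx => ?_) (fun x hx => ?_)
  all_goals
    rw [interior_Icc] at hx
    obtain ⟨h₀, h₁⟩ := hx
  · have h := hasDerivAt_binEntropy (p := (1 - x) / 2) (by linarith) (by linarith)
    have hinner : HasDerivAt (fun y : ℝ => (1 - y) / 2) (-1 / 2) x :=
      ((hasDerivAt_id x).const_sub 1).div_const 2
    have hsq : HasDerivAt (fun y : ℝ => y ^ 2 / 2) x x := by
      simpa using (hasDerivAt_pow 2 x).div_const 2
    exact ((h.comp x hinner).add hsq).hasDerivWithinAt
  · have h := two_mul_le_log_one_add_sub_log_one_sub h₀.le h₁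
    have hsub : 1 - (1 - x) / 2 = (1 + x) / 2 := by ring
    simp only [hsub]
    rw [log_div (by linarith) two_ne_zero, log_div (by linarith) two_ne_zero]
    linarith

/-- Global version of the Taylor expansion of the binary entropy around `1/2`:
`h((1-p)/2) ≤ ln 2 - p²/2` for all `p ∈ [0,1]`. -/
theorem stmt_13 (p : ℝ) (hp : p ∈ Set.Icc (0 : ℝ) 1) :
    binEntropy ((1 - p) / 2) ≤ Real.log 2 - p ^ 2 / 2 := by
  have h := antitoneOn_binEntropy_add_sq_div_two (Set.left_mem_Icc.mpr zero_le_one) hp hp.1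
  norm_num at h
  linarith [binEntropy_le_log_two (p := (1 / 2 : ℝ))]
end

section
/- Tensoring with an independent system changes the conditional min-entropy SDP value only by a trace factor: let S, T, R be nonempty finite types, let ρ be a positive semidefinite complex matrix indexed by S×T, and let σ be a positive semidefinite complex matrix indexed by R with trace c > 0. Then inf{ Tr(K) : K positive semidefinite indexed by T×R such that I_S ⊗ K − ρ ⊗ σ is positive semidefinite } = c · inf{ Tr(K') : K' positive semidefinite indexed by T such that I_S ⊗ K' − ρ is positive semidefinite }, where ⊗ denotes the Kronecker product, I_S is the identity matrix indexed by S, traces of positive semidefinite matrices are regarded as nonnegative reals, and I_S ⊗ K is compared to ρ ⊗ σ under the canonical identification of the index sets S×(T×R) and (S×T)×R. -/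
open scoped Kronecker ComplexOrder

namespace Matrix

/-- The partial trace of a matrix over the second tensor factor. -/
def partialTraceRight {m n α : Type*} [Fintype n] [AddCommMonoid α]
    (M : Matrix (m × n) (m × n) α) : Matrix m m α :=
  ∑ k, M.submatrix (fun i => (i, k)) (fun i => (i, k))

theorem partialTraceRight_apply {m n α : Type*} [Fintype n] [AddCommMonoid α]
    (M : Matrix (m × n) (m × n) α) (i j : m) :
    M.partialTraceRight i j = ∑ k, M (i, k) (j, k) := by
  simp [partialTraceRight, Matrix.sum_apply]

theorem trace_partialTraceRight {m n α : Type*} [Fintype m] [Fintype n] [AddCommMonoid α]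
    (M : Matrix (m × n) (m × n) α) : M.partialTraceRight.trace = M.trace := by
  simp [trace, partialTraceRight_apply, Fintype.sum_prod_type]

theorem PosSemidef.partialTraceRight {m n : Type*} [Fintype n]
    {M : Matrix (m × n) (m × n) ℂ} (hM : M.PosSemidef) : M.partialTraceRight.PosSemidef :=
  posSemidef_sum _ fun _ _ => hM.submatrix _

theorem partialTraceRight_one_kronecker_sub_assoc {S T R : Type*} [Fintype R] [DecidableEq S]
    (K : Matrix (T × R) (T × R) ℂ) (ρ : Matrix (S × T) (S × T) ℂ) (σ : Matrix R R ℂ) :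
    (((1 : Matrix S S ℂ) ⊗ₖ K - reindex (Equiv.prodAssoc S T R) (Equiv.prodAssoc S T R)
      (ρ ⊗ₖ σ)).submatrix (Equiv.prodAssoc S T R) (Equiv.prodAssoc S T R)).partialTraceRight =
      (1 : Matrix S S ℂ) ⊗ₖ K.partialTraceRight - σ.trace • ρ := by
  ext ⟨a, b⟩ ⟨a', b'⟩
  simp [partialTraceRight_apply, trace, Finset.sum_sub_distrib, Finset.mul_sum, mul_comm]
  exact Finset.sum_congr rfl fun _ _ => mul_comm _ _

theorem one_kronecker_sub_reindex_kronecker {S T R : Type*} [DecidableEq S]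
    (K : Matrix T T ℂ) (ρ : Matrix (S × T) (S × T) ℂ) (σ : Matrix R R ℂ) :
    (1 : Matrix S S ℂ) ⊗ₖ (K ⊗ₖ σ) - reindex (Equiv.prodAssoc S T R) (Equiv.prodAssoc S T R)
      (ρ ⊗ₖ σ) =
      (((1 : Matrix S S ℂ) ⊗ₖ K - ρ) ⊗ₖ σ).submatrix
        (Equiv.prodAssoc S T R).symm (Equiv.prodAssoc S T R).symm := by
  ext ⟨a, b, r⟩ ⟨a', b', r'⟩
  simp [sub_mul, mul_assoc]

end Matrix

/-- Tensoring with an independent system changes the conditional min-entropy SDP value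
only by a trace factor: the unsmoothed core of `Hmin(S|TR)_{ρ⊗σ} = Hmin(S|T)_{Tr(σ)·ρ}`. -/
theorem stmt_15 {S T R : Type*} [Fintype S] [Fintype T] [Fintype R]
    [DecidableEq S] [DecidableEq T] [DecidableEq R]
    [Nonempty S] [Nonempty T] [Nonempty R]
    (ρ : Matrix (S × T) (S × T) ℂ) (hρ : ρ.PosSemidef)
    (σ : Matrix R R ℂ) (hσ : σ.PosSemidef)
    (c : ℝ) (hc : 0 < c) (hσtr : σ.trace = (c : ℂ)) :
    sInf { t : ℝ | ∃ K : Matrix (T × R) (T × R) ℂ, K.PosSemidef ∧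
        ((1 : Matrix S S ℂ) ⊗ₖ K -
          (Matrix.reindex (Equiv.prodAssoc S T R) (Equiv.prodAssoc S T R)) (ρ ⊗ₖ σ)).PosSemidef ∧
        t = K.trace.re }
      = c * sInf { t : ℝ | ∃ K' : Matrix T T ℂ, K'.PosSemidef ∧
          ((1 : Matrix S S ℂ) ⊗ₖ K' - ρ).PosSemidef ∧ t = K'.trace.re } := by
  rw [← smul_eq_mul, ← Real.sInf_smul_of_nonneg hc.le]
  congr 1
  ext t
  simp only [Set.mem_smul_set, Set.mem_ofPred_eq, smul_eq_mul]
  constructor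
  · rintro ⟨K, hK, hKρ, rfl⟩
    have hcinv : (0 : ℂ) ≤ ((c⁻¹ : ℝ) : ℂ) := by
      exact_mod_cast (inv_pos.mpr hc).le
    have hc0 : (c : ℂ) ≠ 0 := by exact_mod_cast hc.ne'
    refine ⟨_, ⟨((c⁻¹ : ℝ) : ℂ) • K.partialTraceRight, hK.partialTraceRight.smul hcinv, ?_, rfl⟩, ?_⟩
    · have h := (hKρ.submatrix (Equiv.prodAssoc S T R)).partialTraceRight
      rw [Matrix.partialTraceRight_one_kronecker_sub_assoc, hσtr] at h
      convert h.smul hcinv using 1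
      rw [smul_sub, smul_smul, Matrix.kronecker_smul]
      simp [hc0]
    · rw [Matrix.trace_smul, Matrix.trace_partialTraceRight, smul_eq_mul, Complex.re_ofReal_mul,
        mul_inv_cancel_left₀ hc.ne']
  · rintro ⟨_, ⟨K, hK, hKρ, rfl⟩, rfl⟩
    refine ⟨K ⊗ₖ σ, hK.kronecker hσ, ?_, ?_⟩
    · rw [Matrix.one_kronecker_sub_reindex_kronecker]
      exact (hKρ.kronecker hσ).submatrix _
    · rw [Matrix.trace_kronecker, hσtr, Complex.re_mul_ofReal, mul_comm]
end

section
/- Conditioning on an additional system can only decrease the min-entropy SDP value: let S, T, R be nonempty finite types and let ω be a positive semidefinite complex matrix indexed by (S×T)×R. Let ω_{ST} be its partial trace over R, namely the matrix indexed by S×T with entries (ω_{ST})_{p,q} = Σ_{r∈R} ω_{(p,r),(q,r)}. Then inf{ Tr(K') : K' positive semidefinite indexed by T such that I_S ⊗ K' − ω_{ST} is positive semidefinite } ≤ inf{ Tr(K) : K positive semidefinite indexed by T×R such that I_S ⊗ K − ω is positive semidefinite, under the canonical identification of the index sets S×(T×R) and (S×T)×R }. -/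
open scoped Kronecker ComplexOrder

namespace Matrix

/-- The partial trace over the second tensor factor preserves positive semidefiniteness. -/
lemma PosSemidef.partialTrace_right {n R : Type*} [Fintype R]
    {M : Matrix (n × R) (n × R) ℂ} (hM : M.PosSemidef) :
    (Matrix.of fun p q : n => ∑ r : R, M (p, r) (q, r)).PosSemidef := by
  have h : (Matrix.of fun p q : n => ∑ r : R, M (p, r) (q, r)) =
      ∑ r : R, M.submatrix (fun p => (p, r)) (fun p => (p, r)) := by
    ext p q
    simp [Matrix.sum_apply]
  rw [h]
  exact posSemidef_sum _ fun r _ => hM.submatrix _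

open scoped MatrixOrder Matrix.Norms.L2Operator in
/-- A Hermitian matrix is bounded above by a nonnegative multiple of the identity. -/
lemma IsHermitian.exists_posSemidef_smul_one_sub {n : Type*} [Fintype n] [DecidableEq n]
    {A : Matrix n n ℂ} (hA : A.IsHermitian) :
    ∃ c : ℝ, 0 ≤ c ∧ ((c : ℂ) • (1 : Matrix n n ℂ) - A).PosSemidef := by
  refine ⟨‖A‖, norm_nonneg A, ?_⟩
  have h : A ≤ algebraMap ℝ (Matrix n n ℂ) ‖A‖ := IsSelfAdjoint.le_algebraMap_norm_self hA
  rw [Matrix.le_iff, Algebra.algebraMap_eq_smul_one] at h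
  simpa using h

end Matrix

/-- Conditioning on an additional system can only decrease the min-entropy SDP value:
the unsmoothed form of `Hmin(S|T)_ω ≥ Hmin(S|TR)_ω`, via partial trace of feasible
operators. -/
theorem stmt_16 {S T R : Type*} [Fintype S] [Fintype T] [Fintype R]
    [DecidableEq S] [DecidableEq T] [DecidableEq R]
    [Nonempty S] [Nonempty T] [Nonempty R]
    (ω : Matrix ((S × T) × R) ((S × T) × R) ℂ) (hω : ω.PosSemidef) :
    sInf { t : ℝ | ∃ K' : Matrix T T ℂ, K'.PosSemidef ∧
        ((1 : Matrix S S ℂ) ⊗ₖ K' -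
          Matrix.of (fun p q : S × T => ∑ r : R, ω (p, r) (q, r))).PosSemidef ∧
        t = K'.trace.re }
      ≤ sInf { t : ℝ | ∃ K : Matrix (T × R) (T × R) ℂ, K.PosSemidef ∧
          ((1 : Matrix S S ℂ) ⊗ₖ K -
            (Matrix.reindex (Equiv.prodAssoc S T R) (Equiv.prodAssoc S T R)) ω).PosSemidef ∧
          t = K.trace.re } := by
  refine le_csInf ?_ ?_
  · have hω' := hω.submatrix (Equiv.prodAssoc S T R).symm
    obtain ⟨c, hc, h⟩ := hω'.isHermitian.exists_posSemidef_smul_one_sub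
    refine ⟨_, (c : ℂ) • 1, Matrix.PosSemidef.one.smul (by exact_mod_cast hc), ?_, rfl⟩
    rw [Matrix.kronecker_smul, Matrix.one_kronecker_one]
    exact h
  · rintro _ ⟨K, hK, hKω, rfl⟩
    refine csInf_le ⟨0, ?_⟩
      ⟨Matrix.of fun p q => ∑ r : R, K (p, r) (q, r), hK.partialTrace_right, ?_, ?_⟩
    · rintro _ ⟨K', hK', -, rfl⟩
      exact (Complex.le_def.mp hK'.trace_nonneg).1
    · convert (hKω.submatrix (Equiv.prodAssoc S T R)).partialTrace_right using 1
      ext p q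
      simp [Matrix.kroneckerMap_apply, Finset.mul_sum]
    · simp [Matrix.trace, Fintype.sum_prod_type]
end

section
/- Min-tradeoff lower bound from the parameter-estimation constraints: let g : ℝ → ℝ be an affine function, let γ ∈ (0,1], let c⊥ ∈ ℝ satisfy g(0) ≤ c⊥ ≤ g(1), and let ν ∈ ℝ. Define f₀ := g(0)/γ + (1 − 1/γ)·c⊥ and f₁ := g(1)/γ + (1 − 1/γ)·c⊥. Then for all p₀, p₁, p⊥ ≥ 0 with p₀ + p₁ + p⊥ = 1, p₁ ≥ ν·γ and p₀ ≤ (1−ν)·γ, one has p₀·f₀ + p₁·f₁ + p⊥·c⊥ ≥ g(ν). -/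
/-- Min-tradeoff lower bound from the parameter-estimation constraints: for an affine
function `g`, testing probability `γ`, and `c⊥ ∈ [g(0), g(1)]`, the min-tradeoff
function evaluates to at least `g(ν)` on every accepted frequency distribution. -/
theorem stmt_17 (g : ℝ → ℝ) (m b : ℝ) (hg : ∀ t, g t = m * t + b)
    (γ : ℝ) (hγ : γ ∈ Set.Ioc (0 : ℝ) 1)
    (cperp : ℝ) (hc₀ : g 0 ≤ cperp) (hc₁ : cperp ≤ g 1) (ν : ℝ)
    (p₀ p₁ pperp : ℝ) (hp₀ : 0 ≤ p₀) (hp₁ : 0 ≤ p₁) (hpperp : 0 ≤ pperp)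
    (hsum : p₀ + p₁ + pperp = 1)
    (h₁ : ν * γ ≤ p₁) (h₀ : p₀ ≤ (1 - ν) * γ) :
    g ν ≤ p₀ * (g 0 / γ + (1 - 1 / γ) * cperp)
        + p₁ * (g 1 / γ + (1 - 1 / γ) * cperp) + pperp * cperp := by
  have hγ_pos : 0 < γ := hγ.1
  have hγ_ne : γ ≠ 0 := hγ_pos.ne'
  simp only [hg, mul_zero, zero_add, mul_one] at hc₀ hc₁ ⊢
  have hgap : 0 ≤ (((1 - ν) * γ - p₀) * (cperp - b) + (p₁ - ν * γ) * (m + b - cperp)) / γ :=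
    div_nonneg (add_nonneg (mul_nonneg (sub_nonneg.2 h₀) (sub_nonneg.2 hc₀))
      (mul_nonneg (sub_nonneg.2 h₁) (sub_nonneg.2 hc₁))) hγ_pos.le
  obtain rfl : pperp = 1 - p₀ - p₁ := by linarith
  rw [← sub_nonneg]
  convert hgap using 1
  field_simp
  ring
end
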